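/- Let x⁽⁰⁾ ∈ Kⁿ have pairwise distinct components and satisfy E_f(x⁽⁰⁾) < min{ 1/a , 2/(b + √(b² + 4ab)) } and φ(E_f(x⁽⁰⁾)) ≤ 1, where φ(t) = (a t² (1 + a t)(1 + a + a t) / ((1 − a t)(1 − t − a t²)(1 − b t − a b t²))) · (1 + a t(1 + a t)/((n−1)(1 − b t − a b t²)))^{n−1}. Then the Prešić-Tanabe (Dochev-Byrnev) iteration x⁽ᵏ⁺¹⁾ = 𝒯(x⁽ᵏ⁾) is well defined for all k ≥ 0, satisfies ‖x⁽ᵏ⁾ − x⁽⁰⁾‖ ⪯ (γ(E_f(x⁽⁰⁾))/(1 − β(E_f(x⁽⁰⁾))))·‖W_f(x⁽⁰⁾)‖ with γ(t) = 1 + a t and β(t) = (a t² (1 + a t)(1 + a + a t) / ((1 − a t)(1 − t − a t²))) · (1 + a t(1 + a t)/((n−1)(1 − b t − a b t²)))^{n−1}, and converges to a root vector ξ of f; moreover for all k ≥ 0, ‖x⁽ᵏ⁾ − ξ‖ ⪯ A_k · (θᵏ λ^{(3ᵏ−1)/2} / (1 − θ λ^{3ᵏ})) · ‖W_f(x⁽⁰⁾)‖,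 where λ = φ(E_f(x⁽⁰⁾)), θ = 1 − b·E_f(x⁽⁰⁾) − a b·E_f(x⁽⁰⁾)² and A_k = γ(E_f(x⁽⁰⁾)·λ^{(3ᵏ−1)/2}). (Theorem 4.5 (i),(ii)) -/

import Mathlib

open Finset Polynomial Filter

noncomputable section

/-- The Weierstrass correction `W_i(x) = f(x_i)/(C₀ ∏_{j≠i}(x_i − x_j))`. -/
def Wc {n : ℕ} {K : Type*} [NormedField K] (f : Polynomial K) (x : Fin n → K) (i : Fin n) : K :=
  eval (x i) f / (f.leadingCoeff * ∏ j ∈ univ.erase i, (x i - x j))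

/-- `dmin x i = min_{j ≠ i} ‖x i - x j‖`. -/
def dmin {n : ℕ} {K : Type*} [NormedField K] (x : Fin n → K) (i : Fin n) : ℝ :=
  if h : (univ.erase i).Nonempty then (univ.erase i).inf' h fun j => ‖x i - x j‖ else 0

/-- `E_f(x)` : the ℓ^p norm of the vector `(‖W_i(x)‖ / d_i(x))_i`. -/
def Ef {n : ℕ} {K : Type*} [NormedField K] (p : ENNReal) (f : Polynomial K)
    (x : Fin n → K) : ℝ :=
  ‖(WithLp.equiv p (Fin n → ℝ)).symm (fun i => ‖Wc f x i‖ / dmin x i)‖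

/-- `σ_i(x) = Σ_{j≠i} W_j(x)/(x_i − x_j)`. -/
def sigmaf {n : ℕ} {K : Type*} [NormedField K] (f : Polynomial K) (x : Fin n → K)
    (i : Fin n) : K :=
  ∑ j ∈ univ.erase i, Wc f x j / (x i - x j)

/-- The Ehrlich iteration function. -/
def PhiE {n : ℕ} {K : Type*} [NormedField K] (f : Polynomial K) (x : Fin n → K) : Fin n → K :=
  fun i => x i - Wc f x i / (1 + sigmaf f x i)

/-- The Prešić–Tanabe iteration function. -/
def TnbE {n : ℕ} {K : Type*} [NormedField K] (f : Polynomial K) (x : Fin n → K) : Fin n → K :=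
  fun i => x i - Wc f x i * (1 - sigmaf f x i)

/-- `ξ` is a root vector of `f`, i.e. `f(z) = C₀ ∏ (z − ξᵢ)`. -/
def IsRootVector {n : ℕ} {K : Type*} [NormedField K] (f : Polynomial K) (ξ : Fin n → K) : Prop :=
  f = C f.leadingCoeff * ∏ i, (X - C (ξ i))

/-- `E_f(x)` in the case `p = ∞`: the max of `‖W_i(x)‖ / d_i(x)`. -/
def Einf {n : ℕ} {K : Type*} [NormedField K] (f : Polynomial K) (x : Fin n → K) : ℝ :=
  if h : (univ : Finset (Fin n)).Nonempty then univ.sup' h fun i => ‖Wc f x i‖ / dmin x i else 0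

theorem sum_le_card_rpow_mul_norm {n : ℕ} {p q : ENNReal} (hp : 1 ≤ p) (hpq : p⁻¹ + q⁻¹ = 1)
    (u : Fin n → ℝ) (hu : ∀ i, 0 ≤ u i) (S : Finset (Fin n)) :
    ∑ i ∈ S, u i ≤
      (S.card : ℝ) ^ (ENNReal.toReal q⁻¹) * ‖(WithLp.equiv p (Fin n → ℝ)).symm u‖ := by
  change _ ≤ _ * ‖WithLp.toLp p u‖
  by_cases hpt : p = ⊤
  · subst hpt
    have hq : q⁻¹ = 1 := by simpa using hpq
    rw [hq, ENNReal.toReal_one, Real.rpow_one]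
    have h : ∀ i ∈ S, u i ≤ ‖WithLp.toLp ⊤ u‖ := fun i _ =>
      (le_abs_self _).trans (PiLp.norm_apply_le (WithLp.toLp ⊤ u) i)
    simpa using sum_le_card_nsmul S u _ h
  · have hP : 1 ≤ p.toReal := by
      have := ENNReal.toReal_mono hpt hp
      simpa using this
    have hq : ENNReal.toReal q⁻¹ = 1 - 1 / p.toReal := by
      have hp0 : p⁻¹ ≠ ⊤ := by
        simp only [ne_eq, ENNReal.inv_eq_top]
        rintro rfl
        simp at hp
      have hq0 : q⁻¹ ≠ ⊤ := fun h => by simp [h] at hpq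
      have := congrArg ENNReal.toReal hpq
      rw [ENNReal.toReal_add hp0 hq0, ENNReal.toReal_inv, ENNReal.toReal_one] at this
      rw [one_div]
      linarith
    set P := p.toReal with hPdef
    have hP0 : 0 < P := by linarith
    rw [PiLp.norm_eq_sum hP0]
    have h1 := Real.rpow_sum_le_const_mul_sum_rpow S u hP
    have h2 : ∑ i ∈ S, |u i| ^ P ≤ ∑ i, ‖(WithLp.toLp p u) i‖ ^ P :=
      sum_le_sum_of_subset_of_nonneg (subset_univ _) fun _ _ _ => by positivity
    have h3 : ∑ i ∈ S, |u i| = ∑ i ∈ S, u i := sum_congr rfl fun i _ => abs_of_nonneg (hu i)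
    have hs : 0 ≤ ∑ i ∈ S, u i := sum_nonneg fun i _ => hu i
    rw [h3] at h1
    have h4 := h1.trans (mul_le_mul_of_nonneg_left h2 (by positivity))
    calc ∑ i ∈ S, u i = ((∑ i ∈ S, u i) ^ P) ^ (1 / P) := by
          rw [← Real.rpow_mul hs, mul_one_div_cancel hP0.ne', Real.rpow_one]
      _ ≤ _ := Real.rpow_le_rpow (by positivity) h4 (by positivity)
      _ = _ := by
          rw [Real.mul_rpow (by positivity) (by positivity), ← Real.rpow_mul (by positivity), hq]
          congr 2
          field_simp

theorem prod_one_add_le {ι : Type*} (S : Finset ι) (c : ι → ℝ) (hc : ∀ i ∈ S, 0 ≤ c i) :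
    ∏ i ∈ S, (1 + c i) ≤ (1 + (∑ i ∈ S, c i) / S.card) ^ S.card := by
  rcases S.eq_empty_or_nonempty with rfl | hS
  · simp
  have hN : (0 : ℝ) < S.card := by exact_mod_cast hS.card_pos
  have hp : 0 ≤ ∏ i ∈ S, (1 + c i) := prod_nonneg fun i hi => by linarith [hc i hi]
  have h := Real.geom_mean_le_arith_mean S (fun _ => 1) (fun i => 1 + c i) (by simp)
    (by simpa using hN) (fun i hi => by linarith [hc i hi])
  simp only [Real.rpow_one, one_mul, sum_const, nsmul_eq_mul, mul_one, sum_add_distrib] at h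
  calc _ = ((∏ i ∈ S, (1 + c i)) ^ ((S.card : ℝ)⁻¹)) ^ S.card := by
        rw [Real.rpow_inv_natCast_pow hp (by exact_mod_cast hN.ne')]
    _ ≤ _ := pow_le_pow_left₀ (by positivity) h _
    _ = _ := by congr 1; field_simp

theorem norm_toLp_le_mul {n : ℕ} {p : ENNReal} (hp : 1 ≤ p) (u v : Fin n → ℝ)
    (hu : ∀ i, 0 ≤ u i) {c : ℝ} (hc : 0 ≤ c) (h : ∀ i, u i ≤ c * v i) :
    ‖(WithLp.equiv p (Fin n → ℝ)).symm u‖ ≤ c * ‖(WithLp.equiv p (Fin n → ℝ)).symm v‖ := by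
  change ‖WithLp.toLp p u‖ ≤ c * ‖WithLp.toLp p v‖
  have : Fact (1 ≤ p) := ⟨hp⟩
  have h' : ∀ i, ‖u i‖ ≤ ‖(c • v) i‖ := fun i => by
    rw [Real.norm_of_nonneg (hu i)]
    exact (h i).trans (le_abs_self _)
  have hcv : c * ‖WithLp.toLp p v‖ = ‖WithLp.toLp p (c • v)‖ := by
    rw [WithLp.toLp_smul, norm_smul, Real.norm_of_nonneg hc]
  rw [hcv]
  by_cases hpt : p = ⊤
  · subst hpt
    rw [PiLp.norm_toLp, PiLp.norm_toLp]
    exact (pi_norm_le_iff_of_nonneg (norm_nonneg _)).2 fun i =>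
      (h' i).trans (norm_le_pi_norm (c • v) i)
  · have hP : 0 < p.toReal := ENNReal.toReal_pos (by rintro rfl; simp at hp) hpt
    rw [PiLp.norm_eq_sum hP, PiLp.norm_eq_sum hP]
    refine Real.rpow_le_rpow (sum_nonneg fun _ _ => by positivity) ?_ (by positivity)
    exact sum_le_sum fun i _ => Real.rpow_le_rpow (norm_nonneg _) (h' i) hP.le

section Weierstrass

variable {n : ℕ} {K : Type*} [NormedField K]

theorem dmin_le (x : Fin n → K) {i j : Fin n} (hij : j ≠ i) : dmin x i ≤ ‖x i - x j‖ := by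
  have hj : j ∈ univ.erase i := by simp [hij]
  rw [dmin, dif_pos ⟨j, hj⟩]
  exact inf'_le (fun j => ‖x i - x j‖) hj

theorem le_dmin (hn : 2 ≤ n) (x : Fin n → K) (i : Fin n) {c : ℝ}
    (h : ∀ j, j ≠ i → c ≤ ‖x i - x j‖) : c ≤ dmin x i := by
  have hne : (univ.erase i).Nonempty := by
    rw [← card_pos, card_erase_of_mem (mem_univ i), card_univ, Fintype.card_fin]
    omega
  rw [dmin, dif_pos hne]
  exact le_inf' _ _ fun j hj => h j (ne_of_mem_erase hj)

theorem dmin_pos (hn : 2 ≤ n) {x : Fin n → K} (hx : Function.Injective x) (i : Fin n) :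
    0 < dmin x i := by
  have hne : (univ.erase i).Nonempty := by
    rw [← card_pos, card_erase_of_mem (mem_univ i), card_univ, Fintype.card_fin]
    omega
  rw [dmin, dif_pos hne, lt_inf'_iff]
  exact fun j hj => norm_pos_iff.2 (sub_ne_zero.2 fun h => ne_of_mem_erase hj (hx h).symm)

theorem eq_leadingCoeff_mul_prod_of_eval_eq {f : Polynomial K} (hdeg : f.degree = (n : ℕ))
    (ξ : Fin n → K) {x : Fin n → K} (hx : Function.Injective x) {g : Polynomial K}
    (hg : g.degree < (n : ℕ))
    (h : ∀ i, eval (x i) f = eval (x i) (C f.leadingCoeff * ∏ i, (X - C (ξ i)) + g)) :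
    f = C f.leadingCoeff * ∏ i, (X - C (ξ i)) + g := by
  have hf0 : f ≠ 0 := by rintro rfl; simp at hdeg
  have hlc : f.leadingCoeff ≠ 0 := leadingCoeff_ne_zero.2 hf0
  have hm : (∏ i, (X - C (ξ i))).Monic := monic_prod_X_sub_C ξ univ
  have hd : (C f.leadingCoeff * ∏ i, (X - C (ξ i))).degree = (n : ℕ) := by
    rw [degree_mul, degree_C hlc, degree_prod]
    simp
  have hlt : (f - C f.leadingCoeff * ∏ i, (X - C (ξ i))).degree < (n : ℕ) := by
    rw [← hdeg]
    refine degree_sub_lt_left (hdeg.trans hd.symm) hf0 ?_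
    rw [leadingCoeff_mul, hm.leadingCoeff, leadingCoeff_C, mul_one]
  refine eq_of_degree_sub_lt_of_eval_index_eq univ hx.injOn ?_ fun i _ => h i
  rw [card_univ, Fintype.card_fin, ← sub_sub]
  exact (degree_sub_le _ _).trans_lt (max_lt hlt hg)

/-- Lagrange interpolation of `f` at the nodes `x`, in terms of Weierstrass corrections. -/
theorem eval_eq_prod_add_sum_Wc {f : Polynomial K} (hdeg : f.degree = (n : ℕ)) {x : Fin n → K}
    (hx : Function.Injective x) (z : K) :
    eval z f = f.leadingCoeff *
      (∏ j, (z - x j) + ∑ j, Wc f x j * ∏ k ∈ univ.erase j, (z - x k)) := by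
  have hlc : f.leadingCoeff ≠ 0 := leadingCoeff_ne_zero.2 (by rintro rfl; simp at hdeg)
  have key := eq_leadingCoeff_mul_prod_of_eval_eq hdeg x hx
    (g := ∑ j, C (f.leadingCoeff * Wc f x j) * ∏ k ∈ univ.erase j, (X - C (x k))) ?_ ?_
  · rw [mul_add, mul_sum]
    conv_lhs => rw [key]
    simp [eval_finsetSum, eval_prod, mul_assoc]
  · refine (degree_sum_le _ _).trans_lt ((Finset.sup_lt_iff (WithBot.bot_lt_coe n)).2 ?_)
    intro j _
    refine (degree_mul_le _ _).trans_lt ?_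
    have h1 : (∏ k ∈ univ.erase j, (X - C (x k))).degree = ((n - 1 : ℕ) : WithBot ℕ) := by
      rw [degree_prod]
      simp
    have h2 : ((n - 1 : ℕ) : WithBot ℕ) < (n : ℕ) := by
      exact_mod_cast Nat.sub_lt (Fin.pos j) one_pos
    rw [h1]
    exact (add_le_add_left degree_C_le _).trans_lt (by rw [zero_add]; exact h2)
  · intro i
    rw [eval_add, eval_mul, eval_prod, prod_eq_zero (mem_univ i) (by simp), mul_zero, zero_add,
      eval_finsetSum, sum_eq_single i]
    · have hP : ∏ j ∈ univ.erase i, (x i - x j) ≠ 0 := prod_ne_zero_iff.2 fun j hj =>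
        sub_ne_zero.2 fun h => ne_of_mem_erase hj (hx h).symm
      simp only [eval_mul, eval_C, eval_prod, eval_sub, eval_X, Wc]
      field_simp
    · intro j _ hj
      rw [eval_mul, eval_prod, prod_eq_zero (i := i) (by simp [hj.symm]) (by simp), mul_zero]
    · simp

theorem Wc_eq_mul_prod {f : Polynomial K} (hdeg : f.degree = (n : ℕ)) {x y : Fin n → K}
    (hx : Function.Injective x) (hy : Function.Injective y) (i : Fin n)
    (hyx : ∀ j, j ≠ i → y i ≠ x j) :
    Wc f y i = ((y i - x i) * (1 + ∑ j ∈ univ.erase i, Wc f x j / (y i - x j)) + Wc f x i) *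
      ∏ j ∈ univ.erase i, ((y i - x j) / (y i - y j)) := by
  have hlc : f.leadingCoeff ≠ 0 := leadingCoeff_ne_zero.2 (by rintro rfl; simp at hdeg)
  have hP : ∏ j ∈ univ.erase i, (y i - y j) ≠ 0 := prod_ne_zero_iff.2 fun j hj =>
    sub_ne_zero.2 fun h => ne_of_mem_erase hj (hy h).symm
  have hsum : ∑ j ∈ univ.erase i, Wc f x j * ∏ k ∈ univ.erase j, (y i - x k) =
      (y i - x i) * (∑ j ∈ univ.erase i, Wc f x j / (y i - x j)) *
        ∏ j ∈ univ.erase i, (y i - x j) := by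
    rw [mul_sum, sum_mul]
    refine sum_congr rfl fun j hj => ?_
    have hne : y i - x j ≠ 0 := sub_ne_zero.2 (hyx j (ne_of_mem_erase hj))
    have h := (mul_prod_erase univ (fun k => y i - x k) (mem_univ j)).trans
      (mul_prod_erase univ (fun k => y i - x k) (mem_univ i)).symm
    field_simp
    linear_combination Wc f x j * h
  have hev := eval_eq_prod_add_sum_Wc hdeg hx (y i)
  rw [← mul_prod_erase univ (fun k => y i - x k) (mem_univ i),
    ← add_sum_erase univ (fun j => Wc f x j * _) (mem_univ i), hsum] at hev
  rw [Wc, hev, prod_div_distrib]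
  field_simp
  ring

end Weierstrass

/-- The function `β` of the Prešić–Tanabe iteration. -/
def tnbBeta (n : ℕ) (a b t : ℝ) : ℝ :=
  a * t ^ 2 * (1 + a * t) * (1 + a + a * t) / ((1 - a * t) * (1 - t - a * t ^ 2)) *
    (1 + a * t * (1 + a * t) / (((n : ℝ) - 1) * (1 - b * t - a * b * t ^ 2))) ^ (n - 1)

/-- The parameter `t` lies in the region where the Prešić–Tanabe estimates hold. -/
structure TnbAdmissible (a b t : ℝ) : Prop where
  one_le_a : 1 ≤ a
  one_le_b : 1 ≤ b
  nonneg : 0 ≤ t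
  mul_lt_one : a * t < 1
  pos : 0 < 1 - b * t - a * b * t ^ 2

theorem TnbAdmissible.pos_of_le_one {a b t : ℝ} (h : TnbAdmissible a b t) :
    0 < 1 - t - a * t ^ 2 := by
  have h1 : 0 ≤ t + a * t ^ 2 := by
    have := h.nonneg
    have := h.one_le_a
    positivity
  nlinarith [mul_nonneg (sub_nonneg.2 h.one_le_b) h1, h.pos]

theorem TnbAdmissible.mono {a b s t : ℝ} (h : TnbAdmissible a b t) (hs : 0 ≤ s) (hst : s ≤ t) :
    TnbAdmissible a b s ∧ 1 - b * t - a * b * t ^ 2 ≤ 1 - b * s - a * b * s ^ 2 ∧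
      1 - t - a * t ^ 2 ≤ 1 - s - a * s ^ 2 := by
  have ha : 0 ≤ a := zero_le_one.trans h.one_le_a
  have hb : 0 ≤ b := zero_le_one.trans h.one_le_b
  have h1 : a * s ≤ a * t := by gcongr
  have h2 : b * s ≤ b * t := by gcongr
  have h3 : a * b * s ^ 2 ≤ a * b * t ^ 2 := by gcongr
  have h4 : a * s ^ 2 ≤ a * t ^ 2 := by gcongr
  exact ⟨⟨h.one_le_a, h.one_le_b, hs, h1.trans_lt h.mul_lt_one, by linarith [h.pos]⟩,
    by linarith, by linarith⟩

theorem tnbBeta_nonneg {n : ℕ} (hn : 2 ≤ n) {a b t : ℝ} (h : TnbAdmissible a b t) :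
    0 ≤ tnbBeta n a b t := by
  have ha : 0 ≤ a := zero_le_one.trans h.one_le_a
  have ht := h.nonneg
  have h1 := sub_pos.2 h.mul_lt_one
  have h2 := h.pos_of_le_one
  have h3 := h.pos
  have hn1 : (0 : ℝ) < n - 1 := by
    have : (2 : ℝ) ≤ n := by exact_mod_cast hn
    linarith
  unfold tnbBeta
  positivity

theorem tnbBeta_le_sq_mul {n : ℕ} (hn : 2 ≤ n) {a b s t μ : ℝ} (h : TnbAdmissible a b t)
    (hs : 0 ≤ s) (hμ1 : μ ≤ 1) (hst : s ≤ t * μ) :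
    tnbBeta n a b s ≤ μ ^ 2 * tnbBeta n a b t := by
  have ha : 0 ≤ a := zero_le_one.trans h.one_le_a
  have ht := h.nonneg
  have hle : s ≤ t := hst.trans (mul_le_of_le_one_right ht hμ1)
  obtain ⟨hs', hθ, hψ⟩ := h.mono hs hle
  have h1 := sub_pos.2 h.mul_lt_one
  have h2 := h.pos_of_le_one
  have h3 := h.pos
  have h1' := sub_pos.2 hs'.mul_lt_one
  have h2' := hs'.pos_of_le_one
  have h3' := hs'.pos
  have hn1 : (0 : ℝ) < n - 1 := by
    have : (2 : ℝ) ≤ n := by exact_mod_cast hn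
    linarith
  have hat : a * s ≤ a * t := by gcongr
  unfold tnbBeta
  rw [← mul_assoc, ← mul_div_assoc]
  have hnum : a * s ^ 2 * (1 + a * s) * (1 + a + a * s) ≤
      μ ^ 2 * (a * t ^ 2 * (1 + a * t) * (1 + a + a * t)) :=
    calc a * s ^ 2 * (1 + a * s) * (1 + a + a * s)
        ≤ a * (t * μ) ^ 2 * (1 + a * t) * (1 + a + a * t) := by gcongr
      _ = _ := by ring
  gcongr

/-- Bounds on the relative Weierstrass corrections of `x` that follow from `E_f(x) ≤ t`. -/
structure RelCorrBound {n : ℕ} {K : Type*} [NormedField K] (f : Polynomial K) (x : Fin n → K)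
    (a b t : ℝ) : Prop where
  le : ∀ i, ‖Wc f x i‖ / dmin x i ≤ t
  sum_le : ∀ i, ∑ j ∈ univ.erase i, ‖Wc f x j‖ / dmin x j ≤ a * t
  add_le : ∀ i j, i ≠ j → ‖Wc f x i‖ / dmin x i + ‖Wc f x j‖ / dmin x j ≤ b * t

section Step

variable {n : ℕ} {K : Type*} [NormedField K] {f : Polynomial K} {x : Fin n → K} {a b t : ℝ}

theorem norm_Wc_div_nonneg (f : Polynomial K) (hn : 2 ≤ n) (hx : Function.Injective x)
    (i : Fin n) : 0 ≤ ‖Wc f x i‖ / dmin x i :=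
  div_nonneg (norm_nonneg _) (dmin_pos hn hx i).le

theorem norm_Wc_le (f : Polynomial K) (hn : 2 ≤ n) (hx : Function.Injective x) {i j : Fin n}
    (hij : j ≠ i) : ‖Wc f x i‖ ≤ ‖Wc f x i‖ / dmin x i * ‖x i - x j‖ := by
  have hd := dmin_pos hn hx i
  calc ‖Wc f x i‖ = ‖Wc f x i‖ / dmin x i * dmin x i := by field_simp
    _ ≤ _ := by gcongr; exact dmin_le x hij

theorem RelCorrBound.norm_sigmaf_le (h : RelCorrBound f x a b t) (hn : 2 ≤ n)
    (hx : Function.Injective x) (i : Fin n) : ‖sigmaf f x i‖ ≤ a * t := by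
  refine (norm_sum_le _ _).trans ((sum_le_sum fun j hj => ?_).trans (h.sum_le i))
  rw [norm_div, norm_sub_rev]
  have hd := dmin_pos hn hx j
  gcongr
  exact dmin_le x (ne_of_mem_erase hj).symm

theorem RelCorrBound.norm_TnbE_sub_le (h : RelCorrBound f x a b t) (hn : 2 ≤ n)
    (hx : Function.Injective x) (i : Fin n) : ‖TnbE f x i - x i‖ ≤ (1 + a * t) * ‖Wc f x i‖ := by
  rw [TnbE, sub_sub_cancel_left, norm_neg, norm_mul, mul_comm]
  gcongr
  exact (norm_sub_le _ _).trans (by rw [norm_one]; linarith [h.norm_sigmaf_le hn hx i])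

theorem RelCorrBound.mul_norm_le_norm_TnbE_sub (h : RelCorrBound f x a b t) (hn : 2 ≤ n)
    (ht : TnbAdmissible a b t) (hx : Function.Injective x) {i j : Fin n} (hij : j ≠ i) :
    (1 - t - a * t ^ 2) * ‖x i - x j‖ ≤ ‖TnbE f x i - x j‖ := by
  have hγ : 0 ≤ 1 + a * t := by nlinarith [ht.one_le_a, ht.nonneg]
  have h1 : ‖x i - x j‖ - ‖TnbE f x i - x i‖ ≤ ‖TnbE f x i - x j‖ := by
    rw [norm_sub_rev (TnbE f x i) (x i)]
    refine (norm_sub_norm_le _ _).trans (le_of_eq ?_)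
    congr 1
    ring
  have h2 : ‖Wc f x i‖ ≤ t * ‖x i - x j‖ :=
    (norm_Wc_le f hn hx hij).trans (by gcongr; exact h.le i)
  nlinarith [h.norm_TnbE_sub_le hn hx i, mul_le_mul_of_nonneg_left h2 hγ]

theorem RelCorrBound.mul_norm_le_norm_TnbE_sub_TnbE (h : RelCorrBound f x a b t) (hn : 2 ≤ n)
    (ht : TnbAdmissible a b t) (hx : Function.Injective x) {i j : Fin n} (hij : j ≠ i) :
    (1 - b * t - a * b * t ^ 2) * ‖x i - x j‖ ≤ ‖TnbE f x i - TnbE f x j‖ := by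
  have hγ : 0 ≤ 1 + a * t := by nlinarith [ht.one_le_a, ht.nonneg]
  have h1 : ‖x i - x j‖ ≤
      ‖TnbE f x i - TnbE f x j‖ + ‖TnbE f x i - x i‖ + ‖TnbE f x j - x j‖ := by
    have := norm_add₃_le (a := TnbE f x i - TnbE f x j) (b := -(TnbE f x i - x i))
      (c := TnbE f x j - x j)
    rw [norm_neg] at this
    refine le_of_eq_of_le (congrArg norm ?_) this
    ring
  have h2 : ‖Wc f x i‖ + ‖Wc f x j‖ ≤ b * t * ‖x i - x j‖ := by
    have hi := norm_Wc_le f hn hx hij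
    have hj := norm_Wc_le f hn hx hij.symm
    rw [norm_sub_rev] at hj
    calc _ ≤ (‖Wc f x i‖ / dmin x i + ‖Wc f x j‖ / dmin x j) * ‖x i - x j‖ := by
          rw [add_mul]; exact add_le_add hi hj
      _ ≤ _ := by gcongr; exact h.add_le i j hij.symm
  nlinarith [h.norm_TnbE_sub_le hn hx i, h.norm_TnbE_sub_le hn hx j,
    mul_le_mul_of_nonneg_left h2 hγ]

theorem RelCorrBound.injective_TnbE (h : RelCorrBound f x a b t) (hn : 2 ≤ n)
    (ht : TnbAdmissible a b t) (hx : Function.Injective x) : Function.Injective (TnbE f x) := by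
  intro i j hij
  by_contra hne
  have h1 := h.mul_norm_le_norm_TnbE_sub_TnbE hn ht hx (Ne.symm hne)
  have h2 : 0 < ‖x i - x j‖ := norm_pos_iff.2 (sub_ne_zero.2 fun h => hne (hx h))
  rw [hij, sub_self, norm_zero] at h1
  exact absurd h1 (mul_pos ht.pos h2).not_ge

theorem RelCorrBound.mul_dmin_le (h : RelCorrBound f x a b t) (hn : 2 ≤ n)
    (ht : TnbAdmissible a b t) (hx : Function.Injective x) (i : Fin n) :
    (1 - b * t - a * b * t ^ 2) * dmin x i ≤ dmin (TnbE f x) i := by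
  have h0 := ht.pos
  refine le_dmin hn _ i fun j hj => le_trans ?_ (h.mul_norm_le_norm_TnbE_sub_TnbE hn ht hx hj)
  gcongr
  exact dmin_le x hj

theorem RelCorrBound.sum_norm_Wc_div_le (h : RelCorrBound f x a b t) (hn : 2 ≤ n)
    (ht : TnbAdmissible a b t) (hx : Function.Injective x) (i : Fin n) :
    ∑ j ∈ univ.erase i, ‖Wc f x j‖ / ‖TnbE f x i - x j‖ ≤ a * t / (1 - t - a * t ^ 2) := by
  have hψ := ht.pos_of_le_one
  calc _ ≤ ∑ j ∈ univ.erase i, ‖Wc f x j‖ / dmin x j / (1 - t - a * t ^ 2) := by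
        refine sum_le_sum fun j hj => ?_
        have hji := ne_of_mem_erase hj
        have hd := dmin_pos hn hx j
        rw [div_div]
        gcongr
        refine le_trans ?_ (h.mul_norm_le_norm_TnbE_sub hn ht hx hji)
        rw [mul_comm, norm_sub_rev]
        gcongr
        exact dmin_le x hji.symm
    _ ≤ _ := by
        rw [← sum_div]
        gcongr
        exact h.sum_le i

theorem RelCorrBound.norm_bracket_le (h : RelCorrBound f x a b t) (hn : 2 ≤ n)
    (ht : TnbAdmissible a b t) (hx : Function.Injective x) (i : Fin n) :
    ‖(TnbE f x i - x i) * (1 + ∑ j ∈ univ.erase i, Wc f x j / (TnbE f x i - x j)) + Wc f x i‖ ≤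
      a * t ^ 2 * (1 + a + a * t) / (1 - t - a * t ^ 2) * ‖Wc f x i‖ := by
  have ha := zero_le_one.trans ht.one_le_a
  have ht0 := ht.nonneg
  have hψ := ht.pos_of_le_one
  set S := ∑ j ∈ univ.erase i, Wc f x j / (TnbE f x i - x j) with hS
  have hW := h.sum_norm_Wc_div_le hn ht hx i
  have hSn : ‖S‖ ≤ a * t / (1 - t - a * t ^ 2) :=
    (norm_sum_le _ _).trans (le_of_eq_of_le (by simp only [norm_div]) hW)
  have hσ := h.norm_sigmaf_le hn hx i
  have hdiff : ‖sigmaf f x i - S‖ ≤ (1 + a * t) * t * (a * t / (1 - t - a * t ^ 2)) := by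
    rw [hS, sigmaf, ← sum_sub_distrib]
    refine (norm_sum_le _ _).trans
      (le_trans ?_ (mul_le_mul_of_nonneg_left hW (by positivity)))
    rw [mul_sum]
    refine sum_le_sum fun j hj => ?_
    have hji := ne_of_mem_erase hj
    have hx0 : 0 < ‖x i - x j‖ := norm_pos_iff.2 (sub_ne_zero.2 fun h => hji (hx h).symm)
    have hy0 : 0 < ‖TnbE f x i - x j‖ :=
      (mul_pos hψ hx0).trans_le (h.mul_norm_le_norm_TnbE_sub hn ht hx hji)
    have hx1 := norm_pos_iff.1 hx0
    have hy1 := norm_pos_iff.1 hy0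
    have heq : Wc f x j / (x i - x j) - Wc f x j / (TnbE f x i - x j) =
        (TnbE f x i - x i) / (x i - x j) * (Wc f x j / (TnbE f x i - x j)) := by
      field_simp
      ring
    rw [heq, norm_mul, norm_div, norm_div]
    gcongr
    rw [div_le_iff₀ hx0, mul_assoc]
    refine (h.norm_TnbE_sub_le hn hx i).trans ?_
    gcongr
    exact (norm_Wc_le f hn hx hji).trans (by gcongr; exact h.le i)
  have heq : (TnbE f x i - x i) * (1 + S) + Wc f x i =
      (sigmaf f x i - S + sigmaf f x i * S) * Wc f x i := by
    rw [TnbE]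
    ring
  rw [heq, norm_mul]
  gcongr
  calc ‖sigmaf f x i - S + sigmaf f x i * S‖
      ≤ ‖sigmaf f x i - S‖ + ‖sigmaf f x i‖ * ‖S‖ := by
        rw [← norm_mul]; exact norm_add_le _ _
    _ ≤ (1 + a * t) * t * (a * t / (1 - t - a * t ^ 2)) +
          (a * t) * (a * t / (1 - t - a * t ^ 2)) := by gcongr
    _ = _ := by field_simp; ring

theorem RelCorrBound.norm_prod_le (h : RelCorrBound f x a b t) (hn : 2 ≤ n)
    (ht : TnbAdmissible a b t) (hx : Function.Injective x) (i : Fin n) :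
    ‖∏ j ∈ univ.erase i, ((TnbE f x i - x j) / (TnbE f x i - TnbE f x j))‖ ≤
      (1 + a * t * (1 + a * t) /
        (((n : ℝ) - 1) * (1 - b * t - a * b * t ^ 2))) ^ (n - 1) := by
  have ha := zero_le_one.trans ht.one_le_a
  have ht0 := ht.nonneg
  have hθ := ht.pos
  have hn1 : (0 : ℝ) < n - 1 := by
    have : (2 : ℝ) ≤ n := by exact_mod_cast hn
    linarith
  have hcard : (univ.erase i).card = n - 1 := by simp
  have hcard' : ((univ.erase i).card : ℝ) = n - 1 := by
    rw [hcard, Nat.cast_sub (by omega), Nat.cast_one]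
  set c : Fin n → ℝ := fun j =>
    (1 + a * t) / (1 - b * t - a * b * t ^ 2) * (‖Wc f x j‖ / dmin x j) with hc
  have hc0 : ∀ j, 0 ≤ c j := fun j =>
    mul_nonneg (by positivity) (norm_Wc_div_nonneg f hn hx j)
  have hfac : ∀ j ∈ univ.erase i,
      ‖(TnbE f x i - x j) / (TnbE f x i - TnbE f x j)‖ ≤ 1 + c j := by
    intro j hj
    have hji := ne_of_mem_erase hj
    have hx0 : 0 < ‖x i - x j‖ := norm_pos_iff.2 (sub_ne_zero.2 fun h => hji (hx h).symm)
    have hle := h.mul_norm_le_norm_TnbE_sub_TnbE hn ht hx hji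
    have hy0 : 0 < ‖TnbE f x i - TnbE f x j‖ := (mul_pos hθ hx0).trans_le hle
    have hy1 := norm_pos_iff.1 hy0
    have heq : (TnbE f x i - x j) / (TnbE f x i - TnbE f x j) =
        1 + (TnbE f x j - x j) / (TnbE f x i - TnbE f x j) := by
      field_simp
      ring
    rw [heq]
    refine (norm_add_le _ _).trans ?_
    rw [norm_one, norm_div]
    gcongr
    rw [div_le_iff₀ hy0]
    have hWj := norm_Wc_le f hn hx hji.symm
    rw [norm_sub_rev] at hWj
    calc ‖TnbE f x j - x j‖ ≤ (1 + a * t) * ‖Wc f x j‖ := h.norm_TnbE_sub_le hn hx j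
      _ ≤ (1 + a * t) * (‖Wc f x j‖ / dmin x j * ‖x i - x j‖) := by gcongr
      _ = c j * ((1 - b * t - a * b * t ^ 2) * ‖x i - x j‖) := by
          have hcancel : (1 + a * t) / (1 - b * t - a * b * t ^ 2) *
              (1 - b * t - a * b * t ^ 2) = 1 + a * t := div_mul_cancel₀ _ hθ.ne'
          simp only [hc]
          linear_combination (-(‖Wc f x j‖ / dmin x j * ‖x i - x j‖)) * hcancel
      _ ≤ _ := mul_le_mul_of_nonneg_left hle (hc0 j)
  rw [norm_prod]
  refine (prod_le_prod (fun _ _ => norm_nonneg _) hfac).trans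
    ((prod_one_add_le _ c fun j _ => hc0 j).trans ?_)
  rw [hcard', hcard, hc, ← mul_sum]
  have hs := h.sum_le i
  have hs0 : 0 ≤ ∑ j ∈ univ.erase i, ‖Wc f x j‖ / dmin x j :=
    sum_nonneg fun j _ => norm_Wc_div_nonneg f hn hx j
  refine pow_le_pow_left₀ (by positivity) ?_ _
  calc _ ≤ 1 + (1 + a * t) / (1 - b * t - a * b * t ^ 2) * (a * t) / ((n : ℝ) - 1) := by gcongr
    _ = _ := by field_simp

theorem RelCorrBound.norm_Wc_TnbE_le (h : RelCorrBound f x a b t) (hn : 2 ≤ n)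
    (hdeg : f.degree = (n : ℕ)) (ht : TnbAdmissible a b t) (hx : Function.Injective x)
    (i : Fin n) : ‖Wc f (TnbE f x) i‖ ≤ tnbBeta n a b t * ‖Wc f x i‖ := by
  have ha := zero_le_one.trans ht.one_le_a
  have ht0 := ht.nonneg
  have hψ := ht.pos_of_le_one
  have hθ := ht.pos
  have h1 := sub_pos.2 ht.mul_lt_one
  have hn1 : (0 : ℝ) < n - 1 := by
    have : (2 : ℝ) ≤ n := by exact_mod_cast hn
    linarith
  have hyx : ∀ j, j ≠ i → TnbE f x i ≠ x j := fun j hji heq => by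
    have hx0 : 0 < ‖x i - x j‖ := norm_pos_iff.2 (sub_ne_zero.2 fun h => hji (hx h).symm)
    have := h.mul_norm_le_norm_TnbE_sub hn ht hx hji
    rw [heq, sub_self, norm_zero] at this
    exact absurd this (mul_pos hψ hx0).not_ge
  rw [Wc_eq_mul_prod hdeg hx (h.injective_TnbE hn ht hx) i hyx, norm_mul]
  refine (mul_le_mul (h.norm_bracket_le hn ht hx i) (h.norm_prod_le hn ht hx i) (norm_nonneg _)
    (by positivity)).trans ?_
  rw [mul_right_comm, tnbBeta]
  gcongr ?_ * _ * _
  have hγ : 1 ≤ (1 + a * t) / (1 - a * t) := by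
    rw [one_le_div h1]
    nlinarith [mul_nonneg ha ht0]
  calc _ ≤ a * t ^ 2 * (1 + a + a * t) / (1 - t - a * t ^ 2) * ((1 + a * t) / (1 - a * t)) :=
        le_mul_of_one_le_right (by positivity) hγ
    _ = _ := by field_simp

theorem relCorrBound_Ef (hn : 2 ≤ n) (hx : Function.Injective x) {p q : ENNReal} (hp : 1 ≤ p)
    (hpq : p⁻¹ + q⁻¹ = 1) :
    RelCorrBound f x (((n : ℝ) - 1) ^ (ENNReal.toReal q⁻¹)) (2 ^ (ENNReal.toReal q⁻¹))
      (Ef p f x) := by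
  have key := sum_le_card_rpow_mul_norm hp hpq _ (norm_Wc_div_nonneg f hn hx)
  refine ⟨fun i => ?_, fun i => ?_, fun i j hij => ?_⟩
  · simpa using! key {i}
  · have h := key (univ.erase i)
    rwa [card_erase_of_mem (mem_univ i), card_univ, Fintype.card_fin, Nat.cast_sub (by omega),
      Nat.cast_one] at h
  · have h := key {i, j}
    rwa [sum_pair hij, card_pair hij] at h

theorem Ef_nonneg (p : ENNReal) (hp : 1 ≤ p) (f : Polynomial K) (x : Fin n → K) :
    0 ≤ Ef p f x := by
  have : Fact (1 ≤ p) := ⟨hp⟩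
  exact norm_nonneg (WithLp.toLp p fun i => ‖Wc f x i‖ / dmin x i)

theorem RelCorrBound.Ef_TnbE_le (h : RelCorrBound f x a b t) (hn : 2 ≤ n)
    (hdeg : f.degree = (n : ℕ)) (ht : TnbAdmissible a b t) (hx : Function.Injective x)
    {p : ENNReal} (hp : 1 ≤ p) :
    Ef p f (TnbE f x) ≤ tnbBeta n a b t / (1 - b * t - a * b * t ^ 2) * Ef p f x := by
  have hθ := ht.pos
  have hβ := tnbBeta_nonneg hn ht
  refine norm_toLp_le_mul hp _ _ (norm_Wc_div_nonneg f hn (h.injective_TnbE hn ht hx))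
    (by positivity) fun i => ?_
  have hd := dmin_pos hn hx i
  calc _ ≤ tnbBeta n a b t * ‖Wc f x i‖ / ((1 - b * t - a * b * t ^ 2) * dmin x i) := by
        gcongr
        · exact h.norm_Wc_TnbE_le hn hdeg ht hx i
        · exact h.mul_dmin_le hn ht hx i
    _ = _ := by field_simp

end Step

theorem isRootVector_of_tendsto {n : ℕ} {K : Type*} [NormedField K] {f : Polynomial K}
    (hdeg : f.degree = (n : ℕ)) {x : ℕ → Fin n → K} (hx : ∀ k, Function.Injective (x k))
    {ξ : Fin n → K} (hξ : Tendsto x atTop (nhds ξ))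
    (hW : ∀ i, Tendsto (fun k => Wc f (x k) i) atTop (nhds 0)) : IsRootVector f ξ := by
  have hcomp := tendsto_pi_nhds.1 hξ
  have hev : ∀ z, eval z f = f.leadingCoeff * ∏ j, (z - ξ j) := fun z => by
    have h1 : Tendsto (fun k => ∏ j, (z - x k j)) atTop (nhds (∏ j, (z - ξ j))) :=
      tendsto_finsetProd _ fun j _ => tendsto_const_nhds.sub (hcomp j)
    have h2 : Tendsto (fun k => ∑ j, Wc f (x k) j * ∏ i ∈ univ.erase j, (z - x k i)) atTop
        (nhds (∑ j, 0 * ∏ i ∈ univ.erase j, (z - ξ i))) :=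
      tendsto_finsetSum _ fun j _ => (hW j).mul
        (tendsto_finsetProd _ fun i _ => tendsto_const_nhds.sub (hcomp i))
    have h3 := ((h1.add h2).const_mul f.leadingCoeff).congr fun k =>
      (eval_eq_prod_add_sum_Wc hdeg (hx k) z).symm
    simpa using tendsto_nhds_unique tendsto_const_nhds h3
  have h := eq_leadingCoeff_mul_prod_of_eval_eq hdeg ξ (hx 0) (g := 0)
    (by simp) fun i => by rw [hev]; simp [eval_prod]
  rwa [add_zero] at h

theorem tnbAdmissible_of_lt_min {a b t : ℝ} (ha : 1 ≤ a) (hb : 1 ≤ b) (ht : 0 ≤ t)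
    (h : t < min (1 / a) (2 / (b + Real.sqrt (b ^ 2 + 4 * a * b)))) : TnbAdmissible a b t := by
  obtain ⟨h1, h2⟩ := lt_min_iff.1 h
  have ha0 : 0 < a := by linarith
  have hb0 : 0 < b := by linarith
  refine ⟨ha, hb, ht, by rwa [lt_div_iff₀' ha0] at h1, ?_⟩
  set s := Real.sqrt (b ^ 2 + 4 * a * b) with hs
  have hs2 : s ^ 2 = b ^ 2 + 4 * a * b := Real.sq_sqrt (by positivity)
  have hs0 : 0 ≤ s := Real.sqrt_nonneg _
  have hbs : b ≤ s := Real.le_sqrt_of_sq_le (by nlinarith [mul_pos ha0 hb0])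
  rw [lt_div_iff₀ (by positivity)] at h2
  have hfac : 4 * (1 - b * t - a * b * t ^ 2) = (2 - t * (b + s)) * (2 + t * (s - b)) := by
    linear_combination t ^ 2 * hs2
  have : 0 < (2 - t * (b + s)) * (2 + t * (s - b)) :=
    mul_pos (by linarith) (by nlinarith [mul_nonneg ht (sub_nonneg.2 hbs)])
  linarith

theorem rpow_half_three_pow_succ {l : ℝ} (hl : 0 ≤ l) (k : ℕ) :
    l ^ (((3 : ℝ) ^ (k + 1) - 1) / 2) = l * (l ^ (((3 : ℝ) ^ k - 1) / 2)) ^ 3 := by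
  have h3 : (1 : ℝ) ≤ 3 ^ k := one_le_pow₀ (by norm_num)
  have hs : 0 ≤ ((3 : ℝ) ^ k - 1) / 2 := by linarith
  have : ((3 : ℝ) ^ (k + 1) - 1) / 2 = 1 + ((3 : ℝ) ^ k - 1) / 2 * (3 : ℕ) := by
    push_cast; ring
  rw [this, Real.rpow_add_of_nonneg hl zero_le_one (by positivity), Real.rpow_one,
    Real.rpow_mul_natCast hl]

theorem rpow_three_pow {l : ℝ} (hl : 0 ≤ l) (k : ℕ) :
    l ^ ((3 : ℝ) ^ k) = l * (l ^ (((3 : ℝ) ^ k - 1) / 2)) ^ 2 := by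
  have h3 : (1 : ℝ) ≤ 3 ^ k := one_le_pow₀ (by norm_num)
  have hs : 0 ≤ ((3 : ℝ) ^ k - 1) / 2 := by linarith
  have : (3 : ℝ) ^ k = 1 + ((3 : ℝ) ^ k - 1) / 2 * (2 : ℕ) := by push_cast; ring
  conv_lhs => rw [this]
  rw [Real.rpow_add_of_nonneg hl zero_le_one (by positivity), Real.rpow_one,
    Real.rpow_mul_natCast hl]

theorem dist_zero_le_of_le_geometric {α : Type*} [PseudoMetricSpace α] {y : ℕ → α} {C r : ℝ}
    (hC : 0 ≤ C) (hr0 : 0 ≤ r) (hr : r < 1) (h : ∀ m, dist (y m) (y (m + 1)) ≤ C * r ^ m)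
    (m : ℕ) : dist (y 0) (y m) ≤ C / (1 - r) := by
  refine (dist_le_range_sum_of_dist_le m (d := fun m => C * r ^ m) fun _ => h _).trans ?_
  rw [← mul_sum, div_eq_mul_inv, ← tsum_geometric_of_lt_one hr0 hr]
  exact mul_le_mul_of_nonneg_left
    ((summable_geometric_of_lt_one hr0 hr).sum_le_tsum _ fun _ _ => by positivity) hC

/-- Proinov, Theorem 4.5 (i),(ii): semilocal convergence of the Dochev-Byrnev
(Prešić-Tanabe) method. -/
theorem stmt_18 {n : ℕ} {K : Type*} [NormedField K] [CompleteSpace K] (hn : 2 ≤ n)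
    (f : Polynomial K) (hdeg : f.degree = (n : ℕ))
    (p q : ENNReal) (hp : 1 ≤ p) (hpq : p⁻¹ + q⁻¹ = 1)
    (a b : ℝ) (ha : a = ((n : ℝ) - 1) ^ (ENNReal.toReal q⁻¹))
    (hb : b = (2 : ℝ) ^ (ENNReal.toReal q⁻¹))
    (γ β φ : ℝ → ℝ)
    (hγ : ∀ t, γ t = 1 + a * t)
    (hβ : ∀ t, β t = a * t ^ 2 * (1 + a * t) * (1 + a + a * t) /
        ((1 - a * t) * (1 - t - a * t ^ 2)) *
      (1 + a * t * (1 + a * t) / (((n : ℝ) - 1) * (1 - b * t - a * b * t ^ 2))) ^ (n - 1))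
    (hφ : ∀ t, φ t = a * t ^ 2 * (1 + a * t) * (1 + a + a * t) /
        ((1 - a * t) * (1 - t - a * t ^ 2) * (1 - b * t - a * b * t ^ 2)) *
      (1 + a * t * (1 + a * t) / (((n : ℝ) - 1) * (1 - b * t - a * b * t ^ 2))) ^ (n - 1))
    (x0 : Fin n → K) (hx0 : Function.Injective x0)
    (hE0 : Ef p f x0 < min (1 / a) (2 / (b + Real.sqrt (b ^ 2 + 4 * a * b))))
    (hφ1 : φ (Ef p f x0) ≤ 1)
    (lam θ : ℝ) (hlam : lam = φ (Ef p f x0))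
    (hθ : θ = 1 - b * Ef p f x0 - a * b * Ef p f x0 ^ 2) :
    (∀ k : ℕ, Function.Injective ((TnbE f)^[k] x0)) ∧
    (∀ k : ℕ, ∀ i, ‖(TnbE f)^[k] x0 i - x0 i‖ ≤
      γ (Ef p f x0) / (1 - β (Ef p f x0)) * ‖Wc f x0 i‖) ∧
    ∃ ξ : Fin n → K, IsRootVector f ξ ∧
      Tendsto (fun k => (TnbE f)^[k] x0) atTop (nhds ξ) ∧
      ∀ k : ℕ, ∀ i, ‖(TnbE f)^[k] x0 i - ξ i‖ ≤
        γ (Ef p f x0 * lam ^ (((3 : ℝ) ^ k - 1) / 2)) *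
          (θ ^ k * lam ^ (((3 : ℝ) ^ k - 1) / 2) / (1 - θ * lam ^ ((3 : ℝ) ^ k))) *
          ‖Wc f x0 i‖ := by
  have hn1 : (1 : ℝ) ≤ n - 1 := by
    have : (2 : ℝ) ≤ n := by exact_mod_cast hn
    linarith
  have ha1 : 1 ≤ a := ha ▸ Real.one_le_rpow hn1 ENNReal.toReal_nonneg
  have hb1 : 1 ≤ b := hb ▸ Real.one_le_rpow one_le_two ENNReal.toReal_nonneg
  set t := Ef p f x0 with ht
  have ht0 : 0 ≤ t := Ef_nonneg p hp f x0
  have hadm : TnbAdmissible a b t := tnbAdmissible_of_lt_min ha1 hb1 ht0 hE0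
  have ha0 : 0 ≤ a := by linarith
  have hθ0 : 0 < θ := hθ ▸ hadm.pos
  have hβt : β t = tnbBeta n a b t := hβ t
  have hβ0 := tnbBeta_nonneg hn hadm
  have hβlam : tnbBeta n a b t = θ * lam := by
    rw [hlam, hφ, hθ, tnbBeta, ← mul_assoc, ← div_div (_ * (1 + a + a * t)) _ (1 - b * t - _),
      mul_div_cancel₀ _ hadm.pos.ne']
  have hlam0 : 0 ≤ lam := by
    rw [hβlam] at hβ0
    exact nonneg_of_mul_nonneg_right hβ0 hθ0
  have hlam1 : lam ≤ 1 := hlam ▸ hφ1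
  have hr1 : θ * lam < 1 := by
    rcases ht0.eq_or_lt with h0 | h0
    · rw [← hβlam, ← h0]
      simp [tnbBeta]
    · have : θ < 1 := by
        rw [hθ]
        have : 0 < b * t := by positivity
        have : 0 ≤ a * b * t ^ 2 := by positivity
        linarith
      nlinarith
  set μ : ℕ → ℝ := fun k => lam ^ (((3 : ℝ) ^ k - 1) / 2) with hμ
  have hμ_zero : μ 0 = 1 := by simp [hμ]
  have hμ_succ : ∀ k, μ (k + 1) = lam * μ k ^ 3 := rpow_half_three_pow_succ hlam0
  have hμ0 : ∀ k, 0 ≤ μ k := fun k => Real.rpow_nonneg hlam0 _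
  have hμ1 : ∀ k, μ k ≤ 1 := fun k => Real.rpow_le_one hlam0 hlam1 (by
    have : (1 : ℝ) ≤ 3 ^ k := one_le_pow₀ (by norm_num)
    linarith)
  have hμ_step : ∀ k, μ (k + 1) ≤ μ k := fun k => by
    rw [hμ_succ, pow_succ, ← mul_assoc]
    exact mul_le_of_le_one_left (hμ0 k) (mul_le_one₀ hlam1 (by positivity)
      (pow_le_one₀ (hμ0 k) (hμ1 k)))
  have hμ_anti : Antitone μ := antitone_nat_of_succ_le hμ_step
  set x : ℕ → Fin n → K := fun k => (TnbE f)^[k] x0 with hxdef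
  have hx_succ : ∀ k, x (k + 1) = TnbE f (x k) := fun k => Function.iterate_succ_apply' _ _ _
  have hbound : ∀ k, Function.Injective (x k) → RelCorrBound f (x k) a b (Ef p f (x k)) :=
    fun k hk => ha ▸ hb ▸ relCorrBound_Ef hn hk hp hpq
  have hmono : ∀ k, Ef p f (x k) ≤ t * μ k → TnbAdmissible a b (Ef p f (x k)) ∧
      θ ≤ 1 - b * Ef p f (x k) - a * b * Ef p f (x k) ^ 2 ∧
      tnbBeta n a b (Ef p f (x k)) ≤ θ * lam * μ k ^ 2 := fun k hk => by
    have h := hadm.mono (Ef_nonneg p hp f (x k))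
      (hk.trans (mul_le_of_le_one_right ht0 (hμ1 k)))
    refine ⟨h.1, hθ ▸ h.2.1, ?_⟩
    refine (tnbBeta_le_sq_mul hn hadm (Ef_nonneg p hp f (x k)) (hμ1 k) hk).trans (le_of_eq ?_)
    rw [hβlam]
    ring
  have hiter : ∀ k, Function.Injective (x k) ∧ Ef p f (x k) ≤ t * μ k := fun k => by
    induction k with
    | zero => exact ⟨hx0, by rw [hμ_zero, mul_one]; exact ht.ge⟩
    | succ k ih =>
      obtain ⟨hk, hE⟩ := ih
      obtain ⟨hadmk, hθk, hβk⟩ := hmono k hE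
      rw [hx_succ]
      refine ⟨(hbound k hk).injective_TnbE hn hadmk hk, ?_⟩
      have hE0' := Ef_nonneg p hp f (x k)
      calc _ ≤ _ := (hbound k hk).Ef_TnbE_le hn hdeg hadmk hk hp
        _ ≤ θ * lam * μ k ^ 2 / θ * (t * μ k) := by
          have := hμ0 k
          gcongr
        _ = t * μ (k + 1) := by rw [hμ_succ]; field_simp
  have hW_succ : ∀ k i, ‖Wc f (x (k + 1)) i‖ ≤ θ * lam * μ k ^ 2 * ‖Wc f (x k) i‖ := by
    intro k i
    obtain ⟨hk, hE⟩ := hiter k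
    obtain ⟨hadmk, -, hβk⟩ := hmono k hE
    rw [hx_succ]
    exact ((hbound k hk).norm_Wc_TnbE_le hn hdeg hadmk hk i).trans (by gcongr)
  have hW : ∀ k i, ‖Wc f (x k) i‖ ≤ θ ^ k * μ k * ‖Wc f x0 i‖ := fun k i => by
    induction k with
    | zero => rw [hμ_zero]; simp [hxdef]
    | succ k ih =>
      have := hμ0 k
      calc _ ≤ _ := hW_succ k i
        _ ≤ θ * lam * μ k ^ 2 * (θ ^ k * μ k * ‖Wc f x0 i‖) := by gcongr
        _ = _ := by rw [hμ_succ]; ring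
  have hstep : ∀ k i, ‖x (k + 1) i - x k i‖ ≤ (1 + a * (t * μ k)) * ‖Wc f (x k) i‖ := by
    intro k i
    obtain ⟨hk, hE⟩ := hiter k
    obtain ⟨hadmk, -, -⟩ := hmono k hE
    rw [hx_succ]
    exact ((hbound k hk).norm_TnbE_sub_le hn hk i).trans (by gcongr)
  have hr0 : ∀ k, 0 ≤ θ * lam * μ k ^ 2 := fun k => by positivity
  have hrk : ∀ k, θ * lam * μ k ^ 2 < 1 := fun k =>
    (mul_le_of_le_one_right (by positivity) (pow_le_one₀ (hμ0 k) (hμ1 k))).trans_lt hr1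
  have hWgeo : ∀ k i m, ‖Wc f (x (k + m)) i‖ ≤
      (θ * lam * μ k ^ 2) ^ m * (θ ^ k * μ k * ‖Wc f x0 i‖) := by
    intro k i m
    induction m with
    | zero => simpa using hW k i
    | succ m ih =>
      have h1 := hμ_anti (Nat.le_add_right k m)
      have h2 := hμ0 (k + m)
      have h3 := hr0 k
      calc _ ≤ _ := hW_succ (k + m) i
        _ ≤ θ * lam * μ k ^ 2 * ((θ * lam * μ k ^ 2) ^ m * (θ ^ k * μ k * ‖Wc f x0 i‖)) := by
          gcongr
        _ = _ := by ring
  have hgeo : ∀ k i m, dist (x (k + m) i) (x (k + (m + 1)) i) ≤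
      γ (t * μ k) * (θ ^ k * μ k * ‖Wc f x0 i‖) * (θ * lam * μ k ^ 2) ^ m := by
    intro k i m
    have h1 := hμ_anti (Nat.le_add_right k m)
    have h2 := hμ0 (k + m)
    have h3 := hμ0 k
    rw [dist_comm, dist_eq_norm, hγ]
    calc _ ≤ _ := hstep (k + m) i
      _ ≤ (1 + a * (t * μ k)) *
          ((θ * lam * μ k ^ 2) ^ m * (θ ^ k * μ k * ‖Wc f x0 i‖)) := by
        gcongr
        exact hWgeo k i m
      _ = _ := by ring
  have hgeo0 : ∀ i m, dist (x m i) (x (m + 1) i) ≤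
      γ t * ‖Wc f x0 i‖ * (θ * lam) ^ m := fun i m => by
    have h := hgeo 0 i m
    rwa [hμ_zero, zero_add, zero_add, one_pow, mul_one, mul_one, pow_zero, mul_one, one_mul] at h
  have hγ0 : 0 ≤ γ t := by rw [hγ]; positivity
  choose ξ hξ using fun i =>
    cauchySeq_tendsto_of_complete (cauchySeq_of_le_geometric _ _ hr1 (hgeo0 i))
  have hlim : Tendsto x atTop (nhds ξ) := tendsto_pi_nhds.2 hξ
  refine ⟨fun k => (hiter k).1, fun k i => ?_, ξ, ?_, hlim, fun k i => ?_⟩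
  · have h := dist_zero_le_of_le_geometric (y := fun m => x m i) (by positivity)
      (mul_nonneg hθ0.le hlam0) hr1 (hgeo0 i) k
    rw [dist_comm, dist_eq_norm] at h
    rwa [hβt, hβlam, div_mul_eq_mul_div]
  · refine isRootVector_of_tendsto hdeg (fun k => (hiter k).1) hlim fun i => ?_
    have h0 := (tendsto_pow_atTop_nhds_zero_of_lt_one (mul_nonneg hθ0.le hlam0) hr1).mul_const
      ‖Wc f x0 i‖
    rw [zero_mul] at h0
    refine squeeze_zero_norm (fun k => ?_) h0
    simpa [hμ_zero] using hWgeo 0 i k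
  · have hk : Tendsto (fun m => x (k + m) i) atTop (nhds (ξ i)) := by
      simpa only [add_comm] using (tendsto_add_atTop_iff_nat k).2 (hξ i)
    have h := dist_le_of_le_geometric_of_tendsto₀ _ _ (hrk k) (hgeo k i) hk
    rw [add_zero, dist_eq_norm, mul_assoc θ] at h
    rw [rpow_three_pow hlam0]
    refine h.trans (le_of_eq ?_)
    ring
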